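/- Let Ω ⊂ ℝ² be a planar convex body with width ω. Then for every t ≥ 0, the inner parallel set satisfies |∂Ω_t| ≥ ((1 − 3t/ω)₊) · |∂Ω|, where |∂Ω| denotes the perimeter (the 1-dimensional surface measure of the boundary). (This confirms the conjecture of Geisinger, Laptev and Weidl.) -/

import Mathlib

open Metric MeasureTheory Set
open scoped ENNReal RealInnerProductSpace Pointwise

noncomputable section

variable {n : ℕ}

/-- The inner parallel set `Ω_t = {x ∈ Ω : dist(x, Ωᶜ) ≥ t}`. -/
def innerParallel (Ω : Set (EuclideanSpace ℝ (Fin n))) (t : ℝ) :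
    Set (EuclideanSpace ℝ (Fin n)) :=
  {x ∈ Ω | t ≤ infDist x Ωᶜ}

/-- The inradius: the radius of the largest closed ball contained in `Ω`. -/
def inradius (Ω : Set (EuclideanSpace ℝ (Fin n))) : ℝ :=
  sSup {ρ : ℝ | ∃ x, closedBall x ρ ⊆ Ω}

/-- The Minkowski difference `K ∼ L = {x : x + L ⊆ K}`. -/
def minkDiff (K L : Set (EuclideanSpace ℝ (Fin n))) : Set (EuclideanSpace ℝ (Fin n)) :=
  {x | ∀ y ∈ L, x + y ∈ K}

/-- The support function `h(Ω, u) = sup_{x ∈ Ω} ⟪x, u⟫`. -/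
def supportFn (Ω : Set (EuclideanSpace ℝ (Fin n))) (u : EuclideanSpace ℝ (Fin n)) : ℝ :=
  sSup ((fun x => ⟪x, u⟫) '' Ω)

/-- `u` is an outward unit normal of a supporting hyperplane of `Ω` at `x`. -/
def IsOuterNormalAt (Ω : Set (EuclideanSpace ℝ (Fin n)))
    (x u : EuclideanSpace ℝ (Fin n)) : Prop :=
  ‖u‖ = 1 ∧ ∀ y ∈ Ω, ⟪y, u⟫ ≤ ⟪x, u⟫

/-- `regn Ω`: outward unit normals at regular boundary points (points with a unique
supporting hyperplane, i.e. a unique outward unit normal). -/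
def regn (Ω : Set (EuclideanSpace ℝ (Fin n))) : Set (EuclideanSpace ℝ (Fin n)) :=
  {u | ∃ x ∈ frontier Ω, IsOuterNormalAt Ω x u ∧ ∀ v, IsOuterNormalAt Ω x v → v = u}

/-- The form body `Ω_* = ⋂_{u ∈ regn Ω} {x : ⟪x, u⟫ ≤ 1}`. -/
def formBody (Ω : Set (EuclideanSpace ℝ (Fin n))) : Set (EuclideanSpace ℝ (Fin n)) :=
  ⋂ u ∈ regn Ω, {x | ⟪x, u⟫ ≤ 1}

/-- The width `ω = inf {h(Ω,u) + h(Ω,−u) : u ∈ S^{n−1}}`. -/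
def width (Ω : Set (EuclideanSpace ℝ (Fin n))) : ℝ :=
  sInf ((fun u => supportFn Ω u + supportFn Ω (-u)) '' sphere (0 : EuclideanSpace ℝ (Fin n)) 1)

section Monotonicity

variable {E : Type*} [NormedAddCommGroup E] [InnerProductSpace ℝ E]

/-- A ray starting in a bounded set meets the frontier of that set. -/
lemma exists_add_smul_mem_frontier {L : Set E} (hL : Bornology.IsBounded L) {x u : E}
    (hx : x ∈ L) (hu : u ≠ 0) : ∃ s : ℝ, 0 ≤ s ∧ x + s • u ∈ frontier L := by
  have hg : Continuous fun s : ℝ => x + |s| • u := by fun_prop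
  have hne : ((fun s : ℝ => x + |s| • u) ⁻¹' L).Nonempty := ⟨0, by simpa using hx⟩
  have huniv : (fun s : ℝ => x + |s| • u) ⁻¹' L ≠ univ := by
    intro h
    obtain ⟨R, hR⟩ := hL.exists_norm_le
    have hR0 : 0 ≤ R := (norm_nonneg x).trans (hR x hx)
    have hu' : 0 < ‖u‖ := norm_pos_iff.2 hu
    have hmem : x + |(R + ‖x‖ + 1) / ‖u‖| • u ∈ L := by
      have : (R + ‖x‖ + 1) / ‖u‖ ∈ (fun s : ℝ => x + |s| • u) ⁻¹' L := h ▸ mem_univ _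
      exact this
    have h1 := hR _ hmem
    have h2 : ‖|(R + ‖x‖ + 1) / ‖u‖| • u‖ = R + ‖x‖ + 1 := by
      rw [abs_of_nonneg (by positivity), norm_smul, Real.norm_of_nonneg (by positivity)]
      field_simp
    have h3 := norm_sub_le (x + |(R + ‖x‖ + 1) / ‖u‖| • u) x
    rw [add_sub_cancel_left, h2] at h3
    linarith
  obtain ⟨s, hs⟩ := nonempty_frontier_iff.2 ⟨hne, huniv⟩
  exact ⟨|s|, abs_nonneg s, hg.frontier_preimage_subset L hs⟩

/-- Existence of a supporting hyperplane at a frontier point of a convex body. -/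
lemma exists_supporting_vector [CompleteSpace E] {K : Set E} (hK : Convex ℝ K)
    (hint : (interior K).Nonempty) {x : E} (hx : x ∈ frontier K) :
    ∃ u : E, u ≠ 0 ∧ ∀ k ∈ K, ⟪k - x, u⟫ ≤ 0 := by
  obtain ⟨f, hf⟩ := geometric_hahn_banach_open_point hK.interior isOpen_interior hx.2
  have hfu : ∀ z, ⟪z, (InnerProductSpace.toDual ℝ E).symm f⟫ = f z := fun z => by
    rw [real_inner_comm, InnerProductSpace.toDual_symm_apply]
  refine ⟨(InnerProductSpace.toDual ℝ E).symm f, ?_, fun k hk => ?_⟩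
  · intro h0
    obtain ⟨z, hz⟩ := hint
    have h1 := hf z hz
    rw [← hfu z, ← hfu x, h0, inner_zero_right, inner_zero_right] at h1
    exact lt_irrefl _ h1
  · rw [hfu, map_sub, sub_nonpos]
    have hcl : k ∈ closure (interior K) := by
      rw [hK.closure_interior_eq_closure_of_nonempty_interior hint]
      exact subset_closure hk
    exact closure_minimal (fun a ha => (hf a ha).le)
      (isClosed_le f.continuous continuous_const) hcl

/-- The Hausdorff measure of the boundary of a convex body is at most that of the boundary of any
bounded set containing it. -/
lemma hausdorffMeasure_frontier_mono [CompleteSpace E] [MeasurableSpace E] [BorelSpace E]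
    {K L : Set E} {d : ℝ} (hd : 0 ≤ d) (hK : Convex ℝ K) (hKc : IsClosed K)
    (hint : (interior K).Nonempty) (hL : Bornology.IsBounded L) (hKL : K ⊆ L) :
    μH[d] (frontier K) ≤ μH[d] (frontier L) := by
  have key : ∀ y : E, ∃ p : E, (∃ x ∈ frontier K, ∀ k ∈ K, ⟪k - x, y - x⟫ ≤ 0) →
      p ∈ frontier K ∧ ∀ k ∈ K, ⟪k - p, y - p⟫ ≤ 0 := fun y => by
    by_cases h : ∃ x ∈ frontier K, ∀ k ∈ K, ⟪k - x, y - x⟫ ≤ 0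
    · exact ⟨h.choose, fun _ => h.choose_spec⟩
    · exact ⟨0, fun h' => absurd h' h⟩
  choose p hp using key
  set S : Set E := {y ∈ frontier L | ∃ x ∈ frontier K, ∀ k ∈ K, ⟪k - x, y - x⟫ ≤ 0}
  have contract : ∀ x ∈ K, ∀ x' ∈ K, ∀ y y' : E, (∀ k ∈ K, ⟪k - x, y - x⟫ ≤ 0) →
      (∀ k ∈ K, ⟪k - x', y' - x'⟫ ≤ 0) → dist x x' ≤ dist y y' := by
    intro x hx x' hx' y y' hy hy'
    have h1 := hy x' hx'
    have h2 := hy' x hx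
    have h3 : ⟪x - x', x - x'⟫ ≤ ⟪x - x', y - y'⟫ := by
      have e1 : ⟪x' - x, y - x⟫ = -⟪x - x', y - x⟫ := by
        rw [← inner_neg_left, neg_sub]
      have e2 : ⟪x - x', y - y'⟫ =
          ⟪x - x', y - x⟫ - ⟪x - x', y' - x'⟫ + ⟪x - x', x - x'⟫ := by
        rw [← inner_sub_right, ← inner_add_right]
        congr 1
        abel
      linarith
    have h4 := h3.trans (real_inner_le_norm _ _)
    rw [real_inner_self_eq_norm_mul_norm] at h4
    rw [dist_eq_norm, dist_eq_norm]
    rcases (norm_nonneg (x - x')).eq_or_lt with h0 | h0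
    · rw [← h0]
      positivity
    · exact le_of_mul_le_mul_left h4 h0
  have hlip : LipschitzOnWith 1 p S := by
    refine LipschitzOnWith.of_dist_le_mul fun y hy y' hy' => ?_
    obtain ⟨h1, h2⟩ := hp y hy.2
    obtain ⟨h1', h2'⟩ := hp y' hy'.2
    simpa using contract _ (hKc.frontier_subset h1) _ (hKc.frontier_subset h1') y y' h2 h2'
  have hsub : frontier K ⊆ p '' S := by
    intro x hx
    have hxK := hKc.frontier_subset hx
    obtain ⟨u, hu, hsupp⟩ := exists_supporting_vector hK hint hx
    obtain ⟨s, hs, hfr⟩ := exists_add_smul_mem_frontier hL (hKL hxK) hu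
    have hnormal : ∀ k ∈ K, ⟪k - x, x + s • u - x⟫ ≤ 0 := fun k hk => by
      rw [add_sub_cancel_left, inner_smul_right]
      exact mul_nonpos_of_nonneg_of_nonpos hs (hsupp k hk)
    refine ⟨x + s • u, ⟨hfr, x, hx, hnormal⟩, ?_⟩
    obtain ⟨h1, h2⟩ := hp (x + s • u) ⟨x, hx, hnormal⟩
    have h3 := contract _ (hKc.frontier_subset h1) x hxK _ _ h2 hnormal
    rw [dist_self] at h3
    exact dist_le_zero.1 h3
  calc μH[d] (frontier K) ≤ μH[d] (p '' S) := measure_mono hsub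
    _ ≤ μH[d] S := by simpa using hlip.hausdorffMeasure_image_le hd
    _ ≤ μH[d] (frontier L) := measure_mono (sep_subset _ _)

end Monotonicity

section Homothety

variable {E : Type*} [NormedAddCommGroup E] [NormedSpace ℝ E]

lemma isHomeomorph_homothety (y : E) {c : ℝ} (hc : c ≠ 0) :
    IsHomeomorph (AffineMap.homothety y c : E → E) := by
  refine isHomeomorph_iff_exists_inverse.2 ⟨AffineMap.homothety_continuous y c,
    AffineMap.homothety y c⁻¹, fun x => ?_, fun x => ?_, AffineMap.homothety_continuous y c⁻¹⟩
  · rw [← AffineMap.homothety_mul_apply, inv_mul_cancel₀ hc, AffineMap.homothety_one,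
      AffineMap.id_apply]
  · rw [← AffineMap.homothety_mul_apply, mul_inv_cancel₀ hc, AffineMap.homothety_one,
      AffineMap.id_apply]

lemma image_homothety_frontier (y : E) {c : ℝ} (hc : c ≠ 0) (s : Set E) :
    AffineMap.homothety y c '' frontier s = frontier (AffineMap.homothety y c '' s) :=
  (isHomeomorph_homothety y hc).image_frontier s

lemma image_homothety_interior (y : E) {c : ℝ} (hc : c ≠ 0) (s : Set E) :
    AffineMap.homothety y c '' interior s = interior (AffineMap.homothety y c '' s) :=
  (isHomeomorph_homothety y hc).image_interior s

end Homothety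

section ConvexBody

variable {Ω : Set (EuclideanSpace ℝ (Fin n))}

lemma inner_le_supportFn (hΩ : Bornology.IsBounded Ω) {x : EuclideanSpace ℝ (Fin n)} (hx : x ∈ Ω)
    (u : EuclideanSpace ℝ (Fin n)) : ⟪x, u⟫ ≤ supportFn Ω u := by
  obtain ⟨R, hR⟩ := hΩ.exists_norm_le
  refine le_csSup ⟨R * ‖u‖, ?_⟩ (mem_image_of_mem _ hx)
  rintro _ ⟨z, hz, rfl⟩
  exact (real_inner_le_norm z u).trans (by gcongr; exact hR z hz)

lemma supportFn_le (hΩ : Ω.Nonempty) {u : EuclideanSpace ℝ (Fin n)} {a : ℝ}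
    (h : ∀ x ∈ Ω, ⟪x, u⟫ ≤ a) : supportFn Ω u ≤ a :=
  csSup_le (hΩ.image _) (by rintro _ ⟨z, hz, rfl⟩; exact h z hz)

lemma supportFn_add_supportFn_neg_nonneg (hΩ : Bornology.IsBounded Ω) (hne : Ω.Nonempty)
    (u : EuclideanSpace ℝ (Fin n)) : 0 ≤ supportFn Ω u + supportFn Ω (-u) := by
  obtain ⟨x, hx⟩ := hne
  have h1 := inner_le_supportFn hΩ hx u
  have h2 := inner_le_supportFn hΩ hx (-u)
  rw [inner_neg_right] at h2
  linarith

lemma width_le (hΩ : Bornology.IsBounded Ω) (hne : Ω.Nonempty) {u : EuclideanSpace ℝ (Fin n)}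
    (hu : ‖u‖ = 1) : width Ω ≤ supportFn Ω u + supportFn Ω (-u) := by
  refine csInf_le ⟨0, ?_⟩ (mem_image_of_mem _ (by simpa using hu))
  rintro _ ⟨v, -, rfl⟩
  exact supportFn_add_supportFn_neg_nonneg hΩ hne v

lemma width_pos [NeZero n] (hΩ : Bornology.IsBounded Ω) (hint : (interior Ω).Nonempty) :
    0 < width Ω := by
  obtain ⟨c, hc⟩ := hint
  obtain ⟨ε, hε, hball⟩ := Metric.isOpen_iff.1 isOpen_interior c hc
  have hsub : ball c ε ⊆ Ω := hball.trans interior_subset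
  refine (half_pos hε).trans_le (le_csInf ((NormedSpace.sphere_nonempty.2 zero_le_one).image _) ?_)
  rintro _ ⟨u, hu, rfl⟩
  have hu1 : ‖u‖ = 1 := by simpa using hu
  have hmem : c + (ε / 2) • u ∈ Ω := hsub <| by
    rw [mem_ball, dist_eq_norm, add_sub_cancel_left, norm_smul, hu1,
      Real.norm_of_nonneg (half_pos hε).le]
    linarith
  have h1 := inner_le_supportFn hΩ hmem u
  have h2 := inner_le_supportFn hΩ (hsub (mem_ball_self hε)) (-u)
  rw [inner_add_left, inner_smul_left, real_inner_self_eq_norm_sq, hu1] at h1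
  rw [inner_neg_right] at h2
  simp only [conj_trivial] at h1
  change ε / 2 ≤ supportFn Ω u + supportFn Ω (-u)
  linarith

/-- Minkowski's bound on asymmetry: a convex body contains a point `y` such that reflecting the body
in `y` and shrinking by the factor `1 / n` keeps it inside itself. -/
lemma exists_reflection_center [NeZero n] (hcomp : IsCompact Ω) (hconv : Convex ℝ Ω)
    (hint : (interior Ω).Nonempty) :
    ∃ y, ∀ x ∈ Ω, ∃ z ∈ Ω, ((n : ℝ) + 1) • y = (n : ℝ) • z + x := by
  have hn : (n : ℝ) ≠ 0 := Nat.cast_ne_zero.2 (NeZero.ne n)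
  have hn1 : (n : ℝ) + 1 ≠ 0 := by positivity
  let F : Ω → Set (EuclideanSpace ℝ (Fin n)) := fun x =>
    AffineMap.homothety (x : EuclideanSpace ℝ (Fin n)) ((n : ℝ) / (n + 1)) '' Ω
  have hF : ∀ (x : Ω) (y z : EuclideanSpace ℝ (Fin n)),
      AffineMap.homothety (x : EuclideanSpace ℝ (Fin n)) ((n : ℝ) / (n + 1)) z = y ↔
        ((n : ℝ) + 1) • y = (n : ℝ) • z + x := by
    intro x y z
    rw [← (smul_right_injective _ hn1).eq_iff, eq_comm]
    have : ((n : ℝ) + 1) •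
        AffineMap.homothety (x : EuclideanSpace ℝ (Fin n)) ((n : ℝ) / (n + 1)) z =
          (n : ℝ) • z + x := by
      rw [AffineMap.homothety_apply, vsub_eq_sub, vadd_eq_add, smul_add, smul_smul,
        mul_div_cancel₀ _ hn1, smul_sub, add_smul, one_smul]
      abel
    simp only [this]
  have hinf : Infinite Ω := by
    obtain ⟨c, hc⟩ := hint
    exact (infinite_of_mem_nhds c (mem_interior_iff_mem_nhds.1 hc)).to_subtype
  have hne : (⋂ x, F x).Nonempty := by
    refine Convex.helly_theorem_compact (𝕜 := ℝ) (by simp) (fun x => hconv.affine_image _)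
      (fun x => hcomp.image (AffineMap.homothety_continuous _ _)) fun I hI => ?_
    rw [finrank_euclideanSpace_fin] at hI
    refine ⟨((n : ℝ) + 1)⁻¹ • ∑ i ∈ I, (i : EuclideanSpace ℝ (Fin n)), mem_iInter₂.2 fun x hx => ?_⟩
    classical
    have hcard : (I.erase x).card = n := by rw [Finset.card_erase_of_mem hx, hI]; simp
    refine ⟨∑ i ∈ I.erase x, (n : ℝ)⁻¹ • (i : EuclideanSpace ℝ (Fin n)),
      hconv.sum_mem (fun _ _ => by positivity) ?_ fun i _ => i.2, ?_⟩
    · simp [hcard, hn]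
    · rw [hF, smul_inv_smul₀ hn1, ← Finset.smul_sum, smul_inv_smul₀ hn, Finset.sum_erase_add _ _ hx]
  obtain ⟨y, hy⟩ := hne
  refine ⟨y, fun x hx => ?_⟩
  obtain ⟨z, hz, hzy⟩ := mem_iInter.1 hy ⟨x, hx⟩
  exact ⟨z, hz, (hF ⟨x, hx⟩ y z).1 hzy⟩

/-- A convex body of width `ω` in `ℝⁿ` contains a ball of radius `ω / (n + 1)`. -/
lemma exists_closedBall_width_subset [NeZero n] (hcomp : IsCompact Ω) (hconv : Convex ℝ Ω)
    (hint : (interior Ω).Nonempty) : ∃ y, closedBall y (width Ω / (n + 1)) ⊆ Ω := by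
  obtain ⟨y, hy⟩ := exists_reflection_center hcomp hconv hint
  have hne : Ω.Nonempty := hint.mono interior_subset
  have hn1 : (0 : ℝ) < n + 1 := by positivity
  refine ⟨y, fun w hw => ?_⟩
  by_contra hwΩ
  obtain ⟨f, a, hfa, haw⟩ := geometric_hahn_banach_closed_point hconv hcomp.isClosed hwΩ
  set v := (InnerProductSpace.toDual ℝ (EuclideanSpace ℝ (Fin n))).symm f with hv
  have hfv : ∀ z, ⟪z, v⟫ = f z := fun z => by
    rw [real_inner_comm, hv, InnerProductSpace.toDual_symm_apply]
  have hv0 : v ≠ 0 := by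
    intro h0
    obtain ⟨z, hz⟩ := hne
    have h1 := (hfa z hz).trans haw
    rw [← hfv, ← hfv, h0, inner_zero_right, inner_zero_right] at h1
    exact lt_irrefl _ h1
  have hvpos : 0 < ‖v‖ := norm_pos_iff.2 hv0
  set u := ‖v‖⁻¹ • v with hu
  have hu1 : ‖u‖ = 1 := norm_smul_inv_norm hv0
  have hfu : ∀ z, ⟪z, u⟫ = ‖v‖⁻¹ * f z := fun z => by rw [hu, inner_smul_right, hfv]
  have hlt : supportFn Ω u < ⟪w, u⟫ := by
    refine (supportFn_le hne (a := ‖v‖⁻¹ * a) fun x hx => ?_).trans_lt ?_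
    · rw [hfu]
      exact mul_le_mul_of_nonneg_left (hfa x hx).le (by positivity)
    · rw [hfu]
      exact mul_lt_mul_of_pos_left haw (by positivity)
  have hneg : supportFn Ω (-u) ≤ n * supportFn Ω u - (n + 1) * ⟪y, u⟫ := by
    refine supportFn_le hne fun x hx => ?_
    obtain ⟨z, hz, hzy⟩ := hy x hx
    have h1 := congrArg (fun q => ⟪q, u⟫) hzy
    simp only [inner_add_left, real_inner_smul_left] at h1
    have h2 : (n : ℝ) * ⟪z, u⟫ ≤ n * supportFn Ω u :=
      mul_le_mul_of_nonneg_left (inner_le_supportFn hcomp.isBounded hz u) (by positivity)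
    rw [inner_neg_right]
    linarith
  have hwidth := width_le hcomp.isBounded hne hu1
  have hdist : ⟪w - y, u⟫ ≤ width Ω / (n + 1) := by
    refine (real_inner_le_norm _ _).trans ?_
    rw [hu1, mul_one, ← dist_eq_norm]
    exact hw
  rw [le_div_iff₀ hn1, inner_sub_left] at hdist
  have := mul_lt_mul_of_pos_right hlt hn1
  linarith

/-- If `Ω` contains the ball of radius `r` about `y`, then the homothetic copy of `Ω` with center `y`
and ratio `1 - t / r` lies in the inner parallel set at distance `t`. -/
lemma homothety_image_subset_innerParallel [NeZero n] (hΩ : Bornology.IsBounded Ω)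
    (hconv : Convex ℝ Ω) {y : EuclideanSpace ℝ (Fin n)} {r t : ℝ} (hr : 0 < r)
    (hy : closedBall y r ⊆ Ω) (ht : 0 ≤ t) (htr : t / r ≤ 1) :
    AffineMap.homothety y (1 - t / r) '' Ω ⊆ innerParallel Ω t := by
  rintro _ ⟨z, hz, rfl⟩
  have hball : closedBall (AffineMap.homothety y (1 - t / r) z) t ⊆ Ω := by
    intro w hw
    set x := AffineMap.homothety y (1 - t / r) z with hx
    have hx' : x = (1 - t / r) • z + (t / r) • y := by
      rw [hx, AffineMap.homothety_apply, vsub_eq_sub, vadd_eq_add, smul_sub, sub_smul 1 (t / r) y,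
        one_smul]
      abel
    rcases ht.eq_or_lt with rfl | ht0
    · have hwx : w = x := by simpa using hw
      rw [hwx, hx']
      simpa using hz
    · have hw' : w = (1 - t / r) • z + (t / r) • (y + (r / t) • (w - x)) := by
        have h1 : t / r * (r / t) = 1 := by field_simp
        rw [smul_add, smul_smul, h1, one_smul, ← add_assoc, ← hx']
        abel
      rw [hw']
      refine hconv hz (hy ?_) (sub_nonneg.2 htr) (by positivity) (by ring)
      rw [mem_closedBall, dist_eq_norm, add_sub_cancel_left, norm_smul,
        Real.norm_of_nonneg (by positivity), ← dist_eq_norm]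
      calc r / t * dist w x ≤ r / t * t := by gcongr; exact hw
        _ = r := by field_simp
  have hcompl : Ωᶜ.Nonempty := nonempty_compl.2 fun h => NormedSpace.unbounded_univ ℝ _ (h ▸ hΩ)
  refine ⟨hball (mem_closedBall_self ht), (le_infDist hcompl).2 fun w hw => ?_⟩
  by_contra! hlt
  exact hw (hball (by rw [mem_closedBall, dist_comm]; exact hlt.le))

end ConvexBody

/-- For a planar convex body `Ω ⊂ ℝ²` of width `ω`,
`|∂Ω_t| ≥ (1 − 3t/ω)₊ |∂Ω|` for all `t ≥ 0`. -/
theorem perimeter_innerParallel_ge_width_plane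
    (Ω : Set (EuclideanSpace ℝ (Fin 2))) (hcomp : IsCompact Ω) (hconv : Convex ℝ Ω)
    (hint : (interior Ω).Nonempty) (ω t : ℝ) (hω : ω = width Ω) (ht : 0 ≤ t) :
    ENNReal.ofReal (max (1 - 3 * t / ω) 0) * μH[(1 : ℝ)] (frontier Ω) ≤
      μH[(1 : ℝ)] (frontier (innerParallel Ω t)) := by
  rcases le_or_gt (1 - 3 * t / ω) 0 with hle | hlt
  · simp [max_eq_right hle]
  have hω0 : 0 < ω := hω ▸ width_pos hcomp.isBounded hint
  obtain ⟨y, hy⟩ := exists_closedBall_width_subset hcomp hconv hint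
  rw [← hω] at hy
  have hr : ω / ((2 : ℕ) + 1) = ω / 3 := by norm_num
  rw [hr] at hy
  have hs : t / (ω / 3) = 3 * t / ω := by field_simp
  rw [max_eq_left hlt.le, ← hs]
  rw [← hs] at hlt
  have hc : 1 - t / (ω / 3) ≠ 0 := hlt.ne'
  have hsub := homothety_image_subset_innerParallel hcomp.isBounded hconv (by positivity) hy ht
    (sub_pos.1 hlt).le
  have hfr := image_homothety_frontier y hc Ω
  calc ENNReal.ofReal (1 - t / (ω / 3)) * μH[(1 : ℝ)] (frontier Ω)
      = μH[(1 : ℝ)] (AffineMap.homothety y (1 - t / (ω / 3)) '' frontier Ω) := by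
        rw [hausdorffMeasure_homothety_image zero_le_one y hc, NNReal.rpow_one, ENNReal.smul_def,
          smul_eq_mul, ← enorm_eq_nnnorm, Real.enorm_eq_ofReal hlt.le]
    _ = μH[(1 : ℝ)] (frontier (AffineMap.homothety y (1 - t / (ω / 3)) '' Ω)) := by rw [hfr]
    _ ≤ μH[(1 : ℝ)] (frontier (innerParallel Ω t)) := by
        refine hausdorffMeasure_frontier_mono zero_le_one (hconv.affine_image _)
          (hcomp.image (AffineMap.homothety_continuous y _)).isClosed ?_
          (hcomp.isBounded.subset fun x hx => hx.1) hsub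
        rw [← image_homothety_interior y hc Ω]
        exact hint.image _
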